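/- Let y ∈ [x,3x] ∩ ℕ, K₂ ∈ ℕ and A > 0. Let w = α x^{1/log log x} for some α ∈ [1,2]. Let (c_s) be a sequence with |c_s| ≤ log x for all s, and c_s = 0 whenever gcd(s, P(w)) ≠ 1 or s ≥ x^{1−b−2/K₂}. Then there exist sequences (ξ_d^{(1)}) and (ξ_d^{(2)}), depending on x, with |ξ_d^{(i)}| ≤ 1 for i = 1,2 and ξ_d^{(i)} = 0 for d ≥ x^{1/K₂}, such that E₂ ≤ ∑_s c_s S(A(y)_s, w) − (x^b/τ) ∑_s c_s S(B(y)_s, w) ≤ E₁, where E₁ = ∑_{d s n ∈ A(y), d | P(w)} c_s ξ_d^{(1)} − (x^b/τ) ∑_{d s n ∈ B(y), d | P(w)} c_s ξ_d^{(1)} + O(x/(τ (log x)^A)) and E₂ = ∑_{d s n ∈ A(y), d | P(w)} c_s ξ_d^{(2)} − (x^b/τ) ∑_{d s n ∈ B(y), d | P(w)} c_s ξ_d^{(2)} + O(x/(τ (log x)^A)); here the sums defining E₁, E₂ are over triples (d,s,n) of positive integers with d | P(w) and the product d·s·n lying in A(y) (respectively B(y)), and the implied constants depend only on A and K₂. 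-/

import Mathlib

open scoped Classical BigOperators

noncomputable section

/-- `sift z m` means every prime factor of `m` is at least `z`
(equivalently `gcd(m, P(z)) = 1`). -/
def sift (z : ℝ) (m : ℕ) : Prop := ∀ p : ℕ, p.Prime → p ∣ m → z ≤ (p : ℝ)

/-- `d | P(w)`: `d` is squarefree with all prime factors `< w`. -/
def divPw (w : ℝ) (d : ℕ) : Prop :=
  Squarefree d ∧ ∀ p : ℕ, p.Prime → p ∣ d → (p : ℝ) < w

/-- `∑_s c_s S(C_s, w)` where `C = [lo,hi] ∩ ℕ`:
`S(C_s,w)` counts `n` with `n·s ∈ C` and `gcd(n,P(w)) = 1`. -/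
def siftedCountSum (c : ℕ → ℝ) (lo hi w : ℝ) : ℝ :=
  ∑' s : ℕ, c s *
    (({n : ℕ | lo ≤ ((n * s : ℕ) : ℝ) ∧ ((n * s : ℕ) : ℝ) ≤ hi ∧ sift w n}).ncard : ℝ)

/-- `∑_{d·s·n ∈ [lo,hi], d | P(w)} c_s ξ_d`, the sum being over triples `(d,s,n)`. -/
def tripleSum (c ξ : ℕ → ℝ) (lo hi w : ℝ) : ℝ :=
  ∑' q : ℕ × ℕ × ℕ,
    if lo ≤ ((q.1 * q.2.1 * q.2.2 : ℕ) : ℝ) ∧ ((q.1 * q.2.1 * q.2.2 : ℕ) : ℝ) ≤ hi ∧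
        divPw w q.1 then
      c q.2.1 * ξ q.1
    else 0

/-! ### Mertens-type upper bounds -/

lemma block_log (J : ℕ) :
    ∑ p ∈ (Finset.Ioc (2 ^ J) (2 ^ (J + 1))).filter Nat.Prime, Real.log p / p
      ≤ 2 * Real.log 4 := by
  have h1 : ∑ p ∈ (Finset.Ioc (2 ^ J) (2 ^ (J + 1))).filter Nat.Prime, Real.log p / p
      ≤ ∑ p ∈ (Finset.Ioc (2 ^ J) (2 ^ (J + 1))).filter Nat.Prime, Real.log p / 2 ^ J := by
    apply Finset.sum_le_sum
    intro p hp
    rw [Finset.mem_filter, Finset.mem_Ioc] at hp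
    have : (2 : ℝ) ^ J ≤ p := by exact_mod_cast hp.1.1.le
    apply div_le_div_of_nonneg_left (Real.log_natCast_nonneg p) (by positivity) this
  have h2 : ∑ p ∈ (Finset.Ioc (2 ^ J) (2 ^ (J + 1))).filter Nat.Prime, Real.log p
      ≤ Chebyshev.theta ((2 : ℝ) ^ (J + 1)) := by
    unfold Chebyshev.theta
    have : ⌊(2 : ℝ) ^ (J + 1)⌋₊ = 2 ^ (J + 1) := by
      have : ((2 : ℝ) ^ (J + 1)) = ((2 ^ (J + 1) : ℕ) : ℝ) := by push_cast; ring
      rw [this, Nat.floor_natCast]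
    rw [this]
    apply Finset.sum_le_sum_of_subset_of_nonneg
    · apply Finset.filter_subset_filter
      apply Finset.Ioc_subset_Ioc_left
      positivity
    · intro i _ _
      exact Real.log_natCast_nonneg i
  have h3 := Chebyshev.theta_le_log4_mul_x (x := (2 : ℝ) ^ (J + 1)) (by positivity)
  rw [← Finset.sum_div] at h1
  refine h1.trans ?_
  rw [div_le_iff₀ (by positivity)]
  refine (h2.trans h3).trans (le_of_eq ?_)
  ring

lemma block_inv (J : ℕ) (hJ : 1 ≤ J) :
    ∑ p ∈ (Finset.Ioc (2 ^ J) (2 ^ (J + 1))).filter Nat.Prime, (1 : ℝ) / p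
      ≤ 4 / J := by
  have hl2 : 0 < Real.log 2 := Real.log_pos (by norm_num)
  have hJ' : (0 : ℝ) < J := by exact_mod_cast hJ
  have h1 : ∑ p ∈ (Finset.Ioc (2 ^ J) (2 ^ (J + 1))).filter Nat.Prime, (1 : ℝ) / p
      ≤ ∑ p ∈ (Finset.Ioc (2 ^ J) (2 ^ (J + 1))).filter Nat.Prime,
        (Real.log p / p) / (J * Real.log 2) := by
    apply Finset.sum_le_sum
    intro p hp
    rw [Finset.mem_filter, Finset.mem_Ioc] at hp
    have h2 : (2 : ℝ) ^ J ≤ p := by exact_mod_cast hp.1.1.le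
    have hp0 : (0 : ℝ) < p := by exact_mod_cast hp.2.pos
    have h3 : J * Real.log 2 ≤ Real.log p := by
      rw [← Real.log_pow]
      exact Real.log_le_log (by positivity) h2
    rw [div_div, div_le_div_iff₀ hp0 (by positivity)]
    nlinarith
  rw [← Finset.sum_div] at h1
  refine h1.trans ?_
  have := block_log J
  have h4 : Real.log 4 = 2 * Real.log 2 := by
    rw [show (4 : ℝ) = 2 ^ 2 by norm_num, Real.log_pow]; norm_num
  rw [div_le_div_iff₀ (by positivity) hJ']
  rw [h4] at this
  nlinarith

lemma split_block (f : ℕ → ℝ) (J : ℕ) :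
    ∑ p ∈ (Finset.Ioc 0 (2 ^ (J + 1))).filter Nat.Prime, f p =
      ∑ p ∈ (Finset.Ioc 0 (2 ^ J)).filter Nat.Prime, f p +
      ∑ p ∈ (Finset.Ioc (2 ^ J) (2 ^ (J + 1))).filter Nat.Prime, f p := by
  rw [← Finset.sum_union]
  · rw [← Finset.filter_union, Finset.Ioc_union_Ioc_eq_Ioc (by positivity)
      (Nat.pow_le_pow_right (by norm_num) (by omega))]
  · apply Finset.disjoint_filter_filter
    rw [Finset.disjoint_left]
    intro a ha hb
    rw [Finset.mem_Ioc] at ha hb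
    omega

lemma mertens_log (J : ℕ) :
    ∑ p ∈ (Finset.Ioc 0 (2 ^ J)).filter Nat.Prime, Real.log p / p ≤ 4 * J := by
  induction J with
  | zero =>
    have : (Finset.Ioc 0 (2 ^ 0)).filter Nat.Prime = ∅ := by decide
    rw [this]; simp
  | succ J ih =>
    rw [split_block]
    have := block_log J
    have h4 : Real.log 4 = 2 * Real.log 2 := by
      rw [show (4 : ℝ) = 2 ^ 2 by norm_num, Real.log_pow]; norm_num
    have := Real.log_two_lt_d9
    push_cast
    linarith

lemma mertens_inv (J : ℕ) (hJ : 1 ≤ J) :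
    ∑ p ∈ (Finset.Ioc 0 (2 ^ J)).filter Nat.Prime, (1 : ℝ) / p
      ≤ 1 + 4 * (1 + Real.log J) := by
  have key : ∀ J : ℕ, ∑ p ∈ (Finset.Ioc 0 (2 ^ (J + 1))).filter Nat.Prime, (1 : ℝ) / p
      ≤ 1 + 4 * (harmonic J : ℝ) := by
    intro J
    induction J with
    | zero =>
      have : (Finset.Ioc 0 (2 ^ (0 + 1))).filter Nat.Prime = {2} := by decide
      rw [this]; norm_num
    | succ J ih =>
      rw [split_block, harmonic_succ]
      have := block_inv (J + 1) (by omega)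
      push_cast at this ⊢
      rw [div_eq_mul_inv] at this
      linarith
  obtain ⟨k, rfl⟩ : ∃ k, J = k + 1 := ⟨J - 1, by omega⟩
  refine (key k).trans ?_
  have h1 := harmonic_le_one_add_log k
  rcases Nat.eq_zero_or_pos k with rfl | hk
  · simp
  have h2 : Real.log k ≤ Real.log ((k + 1 : ℕ) : ℝ) :=
    Real.log_le_log (by exact_mod_cast hk) (by push_cast; linarith)
  linarith

/-- primes below `w` -/
def primesBelow (w : ℝ) : Finset ℕ := (Finset.range ⌈w⌉₊).filter Nat.Prime

lemma mem_primesBelow {w : ℝ} {p : ℕ} : p ∈ primesBelow w ↔ p.Prime ∧ (p : ℝ) < w := by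
  unfold primesBelow
  rw [Finset.mem_filter, Finset.mem_range, Nat.lt_ceil, and_comm]

lemma sum_rankin (w K : ℝ) (hw : 1 ≤ Real.log w) (hw0 : 0 < w) (hK : 0 ≤ K) :
    ∑ p ∈ primesBelow w, (p : ℝ) ^ (K / Real.log w - 1) ≤
      4 * Real.log (Real.log w) + (13 + 12 * K * Real.exp K) := by
  set J := ⌈Real.log w / Real.log 2⌉₊ with hJ
  have hl2 : 0 < Real.log 2 := Real.log_pos (by norm_num)
  have hl2a := Real.log_two_gt_d9
  have hl2b := Real.log_two_lt_d9
  have hlw : 0 < Real.log w := by linarith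
  have hJ1 : 1 ≤ J := by
    rw [hJ, Nat.one_le_ceil_iff]; positivity
  have hJ3 : (J : ℝ) ≤ 3 * Real.log w := by
    have := Nat.ceil_lt_add_one (a := Real.log w / Real.log 2) (by positivity)
    have h2 : Real.log w / Real.log 2 ≤ 2 * Real.log w := by
      rw [div_le_iff₀ hl2]; nlinarith
    linarith
  have hwJ : w ≤ 2 ^ J := by
    have h1 : Real.log w / Real.log 2 ≤ J := Nat.le_ceil _
    rw [div_le_iff₀ hl2, ← Real.log_pow] at h1
    exact (Real.log_le_log_iff hw0 (by positivity)).1 h1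
  have hsub : primesBelow w ⊆ (Finset.Ioc 0 (2 ^ J)).filter Nat.Prime := by
    intro p hp
    rw [mem_primesBelow] at hp
    rw [Finset.mem_filter, Finset.mem_Ioc]
    refine ⟨⟨hp.1.pos, ?_⟩, hp.1⟩
    have : (p : ℝ) ≤ 2 ^ J := by linarith
    exact_mod_cast this
  have hterm : ∀ p ∈ primesBelow w, (p : ℝ) ^ (K / Real.log w - 1) ≤
      1 / p + (K * Real.exp K / Real.log w) * (Real.log p / p) := by
    intro p hp
    rw [mem_primesBelow] at hp
    have hp0 : (0 : ℝ) < p := by exact_mod_cast hp.1.pos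
    have hlp : 0 ≤ Real.log p := Real.log_natCast_nonneg p
    have hlpw : Real.log p ≤ Real.log w := Real.log_le_log hp0 hp.2.le
    rw [Real.rpow_sub_one hp0.ne', Real.rpow_def_of_pos hp0]
    set t := Real.log p * (K / Real.log w) with ht
    have ht0 : 0 ≤ t := by positivity
    have htK : t ≤ K := by
      rw [ht, ← mul_div_assoc, div_le_iff₀ hlw]; nlinarith
    have h1 : Real.exp t ≤ 1 + t * Real.exp t := by
      have := Real.add_one_le_exp (-t)
      have h2 : Real.exp (-t) * Real.exp t = 1 := by rw [← Real.exp_add]; simp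
      nlinarith [Real.exp_pos t]
    have h2 : t * Real.exp t ≤ t * Real.exp K :=
      mul_le_mul_of_nonneg_left (Real.exp_le_exp.2 htK) ht0
    have h3 : 1 / (p : ℝ) + (K * Real.exp K / Real.log w) * (Real.log p / p)
        = (1 + t * Real.exp K) / p := by
      rw [ht]; field_simp
    rw [h3]
    gcongr
    linarith
  refine (Finset.sum_le_sum hterm).trans ?_
  rw [Finset.sum_add_distrib, ← Finset.mul_sum]
  have a1 : ∑ p ∈ primesBelow w, (1 : ℝ) / p ≤ 1 + 4 * (1 + Real.log J) :=
    (Finset.sum_le_sum_of_subset_of_nonneg hsub (fun i _ _ => by positivity)).trans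
      (mertens_inv J hJ1)
  have a2 : ∑ p ∈ primesBelow w, Real.log p / (p : ℝ) ≤ 4 * J :=
    (Finset.sum_le_sum_of_subset_of_nonneg hsub
      (fun i _ _ => div_nonneg (Real.log_natCast_nonneg i) (by positivity))).trans
      (mertens_log J)
  have a3 : Real.log J ≤ 2 + Real.log (Real.log w) := by
    have : Real.log J ≤ Real.log (3 * Real.log w) :=
      Real.log_le_log (by exact_mod_cast hJ1) hJ3
    rw [Real.log_mul (by norm_num) hlw.ne'] at this
    have h3 : Real.log 3 ≤ 2 := by
      have := Real.log_le_sub_one_of_pos (x := 3) (by norm_num)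
      linarith
    linarith
  have a4 : (K * Real.exp K / Real.log w) * ∑ p ∈ primesBelow w, Real.log p / (p : ℝ)
      ≤ 12 * K * Real.exp K := by
    calc _ ≤ (K * Real.exp K / Real.log w) * (4 * (3 * Real.log w)) := by
          gcongr
          linarith
      _ = 12 * K * Real.exp K := by field_simp; ring
  linarith

lemma rankin (w D η : ℝ) (hD : 0 < D) (hη : 0 ≤ η) (T : Finset ℕ)
    (hT : ∀ d ∈ T, divPw w d ∧ D ≤ d) :
    ∑ d ∈ T, (1 : ℝ) / d ≤
      D ^ (-η) * Real.exp (∑ p ∈ primesBelow w, (p : ℝ) ^ (η - 1)) := by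
  have h1 : ∀ d ∈ T, (1 : ℝ) / d ≤ D ^ (-η) * ∏ p ∈ d.primeFactors, (p : ℝ) ^ (η - 1) := by
    intro d hd
    obtain ⟨⟨hsq, -⟩, hDd⟩ := hT d hd
    have hd0 : (0 : ℝ) < d := by linarith
    have h2 : ∏ p ∈ d.primeFactors, (p : ℝ) ^ (η - 1) = (d : ℝ) ^ (η - 1) := by
      rw [Real.finsetProd_rpow _ _ (fun i _ => by positivity), ← Nat.cast_prod,
        Nat.prod_primeFactors_of_squarefree hsq]
    rw [h2, Real.rpow_neg hD.le, Real.rpow_sub_one hd0.ne', inv_mul_eq_div, div_div,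
      div_le_div_iff₀ hd0 (by positivity)]
    have := Real.rpow_le_rpow hD.le hDd hη
    nlinarith
  refine (Finset.sum_le_sum h1).trans ?_
  rw [← Finset.mul_sum]
  refine mul_le_mul_of_nonneg_left ?_ (by positivity)
  have hinj : Set.InjOn Nat.primeFactors (T : Set ℕ) := by
    intro a ha b hb hab
    rw [← Nat.prod_primeFactors_of_squarefree (hT a ha).1.1,
      ← Nat.prod_primeFactors_of_squarefree (hT b hb).1.1, hab]
  calc ∑ d ∈ T, ∏ p ∈ d.primeFactors, (p : ℝ) ^ (η - 1)
      = ∑ S ∈ T.image Nat.primeFactors, ∏ p ∈ S, (p : ℝ) ^ (η - 1) := by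
        rw [Finset.sum_image hinj]
    _ ≤ ∑ S ∈ (primesBelow w).powerset, ∏ p ∈ S, (p : ℝ) ^ (η - 1) := by
        apply Finset.sum_le_sum_of_subset_of_nonneg
        · intro S hS
          rw [Finset.mem_image] at hS
          obtain ⟨d, hd, rfl⟩ := hS
          rw [Finset.mem_powerset]
          intro p hp
          rw [mem_primesBelow]
          have hpp := Nat.prime_of_mem_primeFactors hp
          exact ⟨hpp, (hT d hd).1.2 p hpp (Nat.dvd_of_mem_primeFactors hp)⟩
        · intro S _ _
          exact Finset.prod_nonneg (fun i _ => by positivity)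
    _ = ∏ p ∈ primesBelow w, (1 + (p : ℝ) ^ (η - 1)) := (Finset.prod_one_add _).symm
    _ ≤ ∏ p ∈ primesBelow w, Real.exp ((p : ℝ) ^ (η - 1)) := by
        apply Finset.prod_le_prod
        · intro i _; positivity
        · intro i _
          rw [add_comm]; exact Real.add_one_le_exp _
    _ = _ := (Real.exp_sum _ _).symm

/-! ### The sieve identity -/

/-- truncated Moebius weights -/
def xi (D : ℝ) (d : ℕ) : ℝ := if (d : ℝ) < D then (ArithmeticFunction.moebius d : ℝ) else 0

lemma abs_xi_le (D : ℝ) (d : ℕ) : |xi D d| ≤ 1 := by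
  unfold xi
  split_ifs
  · exact_mod_cast ArithmeticFunction.abs_moebius_le_one
  · simp

/-- the sieving sum -/
def theta' (w D : ℝ) (n : ℕ) : ℝ := ∑ d ∈ n.divisors.filter (divPw w), xi D d

/-- boundary divisors -/
def bdry (w D : ℝ) (n : ℕ) : Finset ℕ :=
  n.divisors.filter (fun d => divPw w d ∧ D ≤ (d : ℝ) ∧ (d : ℝ) < D * w)

lemma sieve_ineq (w D : ℝ) (hD : 1 < D) (n : ℕ) (hn : n ≠ 0) :
    |(if sift w n then (1 : ℝ) else 0) - theta' w D n| ≤ (bdry w D n).card := by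
  by_cases hs : sift w n
  · have h1 : n.divisors.filter (divPw w) = {1} := by
      ext d
      rw [Finset.mem_filter, Nat.mem_divisors, Finset.mem_singleton]
      constructor
      · rintro ⟨⟨hdn, -⟩, -, hd⟩
        by_contra hd1
        obtain ⟨p, hp, hpd⟩ := Nat.exists_prime_and_dvd hd1
        have := hd p hp hpd
        have := hs p hp (hpd.trans hdn)
        linarith
      · rintro rfl
        refine ⟨⟨one_dvd _, hn⟩, squarefree_one, ?_⟩
        intro p hp h
        exact absurd (Nat.dvd_one.1 h) hp.one_lt.ne'
    rw [theta', h1]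
    simp [hs, xi, hD]
  · simp only [hs, if_false, zero_sub, abs_neg]
    have : ∃ p : ℕ, p.Prime ∧ p ∣ n ∧ (p : ℝ) < w := by
      unfold sift at hs; push Not at hs; exact hs
    obtain ⟨p, hp, hpn, hpw⟩ := this
    set F0 := (n.divisors.filter (divPw w)).filter (fun d => ¬ p ∣ d) with hF0
    have hF1 : (n.divisors.filter (divPw w)).filter (fun d => p ∣ d) = F0.image (fun d => p * d) := by
      ext d
      simp only [hF0, Finset.mem_image, Finset.mem_filter, Nat.mem_divisors]
      constructor
      · rintro ⟨⟨⟨hdn, -⟩, hsq, hd⟩, e, rfl⟩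
        have hcop : p.Coprime e := Nat.coprime_of_squarefree_mul hsq
        refine ⟨e, ⟨⟨⟨(Dvd.intro_left p rfl).trans hdn, hn⟩,
          hsq.squarefree_of_dvd (Dvd.intro_left p rfl), ?_⟩, ?_⟩, rfl⟩
        · intro q hq hqe
          exact hd q hq (hqe.mul_left p)
        · exact (Nat.Prime.coprime_iff_not_dvd hp).1 hcop
      · rintro ⟨e, ⟨⟨⟨hen, -⟩, hsq, he⟩, hpe⟩, rfl⟩
        have hcop : p.Coprime e := (Nat.Prime.coprime_iff_not_dvd hp).2 hpe
        refine ⟨⟨⟨hcop.mul_dvd_of_dvd_of_dvd hpn hen, hn⟩,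
          (Nat.squarefree_mul hcop).2 ⟨hp.squarefree, hsq⟩, ?_⟩, Dvd.intro e rfl⟩
        intro q hq hqd
        rcases (Nat.Prime.dvd_mul hq).1 hqd with h | h
        · rw [(Nat.prime_dvd_prime_iff_eq hq hp).1 h]; exact hpw
        · exact he q hq h
    have hsum : theta' w D n = ∑ d ∈ F0, (xi D (p * d) + xi D d) := by
      rw [theta', ← Finset.sum_filter_add_sum_filter_not _ (fun d => p ∣ d), hF1,
        Finset.sum_image, Finset.sum_add_distrib]
      intro a _ b _ hab
      exact Nat.eq_of_mul_eq_mul_left hp.pos hab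
    have hp1 : (1 : ℝ) ≤ p := by exact_mod_cast hp.one_lt.le
    have hterm : ∀ d ∈ F0, |xi D (p * d) + xi D d| ≤
        if (d : ℝ) < D ∧ D ≤ p * d then 1 else 0 := by
      intro d hd
      rw [hF0, Finset.mem_filter] at hd
      have hcop : p.Coprime d := (Nat.Prime.coprime_iff_not_dvd hp).2 hd.2
      have hmu : (ArithmeticFunction.moebius (p * d) : ℝ) = - ArithmeticFunction.moebius d := by
        rw [ArithmeticFunction.isMultiplicative_moebius.map_mul_of_coprime hcop,
          ArithmeticFunction.moebius_apply_prime hp]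
        simp
      have hdle : (d : ℝ) ≤ p * d := by
        nlinarith [(Nat.cast_nonneg d : (0:ℝ) ≤ d)]
      by_cases h1 : (p : ℝ) * d < D
      · have h2 : (d : ℝ) < D := by linarith
        have h3 : ¬ (D ≤ (p : ℝ) * d) := by linarith
        unfold xi
        push_cast
        simp [h1, h2, h3, hmu]
      · by_cases h2 : (d : ℝ) < D
        · have h4 : D ≤ (p : ℝ) * d := by linarith
          have h3 : xi D (p * d) = 0 := by
            unfold xi; push_cast; simp [h1]
          rw [h3, zero_add, if_pos ⟨h2, h4⟩]
          exact abs_xi_le D d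
        · unfold xi
          push_cast
          simp [h1, h2]
    rw [hsum]
    refine (Finset.abs_sum_le_sum_abs _ _).trans ((Finset.sum_le_sum hterm).trans ?_)
    rw [← Finset.sum_filter, Finset.sum_const, nsmul_eq_mul, mul_one]
    norm_cast
    apply Finset.card_le_card_of_injOn (fun d => p * d)
    · intro d hd
      rw [Finset.mem_coe, Finset.mem_filter] at hd
      have hm : p * d ∈ (n.divisors.filter (divPw w)).filter (fun d => p ∣ d) := by
        rw [hF1]; exact Finset.mem_image_of_mem _ hd.1
      rw [Finset.mem_filter, Finset.mem_filter] at hm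
      rw [Finset.mem_coe, bdry, Finset.mem_filter]
      refine ⟨hm.1.1, hm.1.2, ?_, ?_⟩
      · exact_mod_cast hd.2.2
      · push_cast
        have : (0:ℝ) ≤ d := Nat.cast_nonneg d
        nlinarith [hd.2.1]
    · intro a _ b _ hab
      exact Nat.eq_of_mul_eq_mul_left hp.pos hab

/-! ### Rough divisors -/

lemma sift_of_mul {w : ℝ} {a b : ℕ} (h : sift w (a * b)) : sift w b :=
  fun p hp hpb => h p hp (hpb.mul_left a)

lemma rough_divisors (w : ℝ) (hw : 1 < w) (m : ℕ) :
    m ≠ 0 → ((m.divisors.filter (sift w)).card : ℝ) ≤ (m : ℝ) ^ (Real.log 2 / Real.log w) := by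
  have hlw : 0 < Real.log w := Real.log_pos hw
  have hl2 : 0 < Real.log 2 := Real.log_pos (by norm_num)
  have hw2 : w ^ (Real.log 2 / Real.log w) = 2 := by
    rw [Real.rpow_def_of_pos (by linarith), mul_div_cancel₀ _ hlw.ne', Real.exp_log (by norm_num)]
  induction m using induction_on_primes with
  | zero => intro h; exact absurd rfl h
  | one =>
    intro _
    have : (Nat.divisors 1).filter (sift w) ⊆ {1} := by
      rw [Nat.divisors_one]; exact Finset.filter_subset _ _
    have h2 := Finset.card_le_card this
    simp only [Finset.card_singleton] at h2
    simp only [Nat.cast_one, Real.one_rpow]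
    exact_mod_cast h2
  | prime_mul p m hp ih =>
    intro hpm
    have hm : m ≠ 0 := by rintro rfl; simp at hpm
    have ih := ih hm
    have hp1 : (1 : ℝ) ≤ p := by exact_mod_cast hp.one_lt.le
    push_cast
    rw [Real.mul_rpow (by positivity) (by positivity)]
    have hm0 : 0 ≤ (m : ℝ) ^ (Real.log 2 / Real.log w) := by positivity
    by_cases hpw : w ≤ p
    · have hp2 : 2 ≤ (p : ℝ) ^ (Real.log 2 / Real.log w) := by
        refine hw2.symm.le.trans ?_
        apply Real.rpow_le_rpow (by linarith) hpw (by positivity)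
      have hsub : (p * m).divisors.filter (sift w) ⊆
          m.divisors.filter (sift w) ∪ (m.divisors.filter (sift w)).image (fun d => p * d) := by
        intro s hs
        rw [Finset.mem_filter, Nat.mem_divisors] at hs
        rw [Finset.mem_union, Finset.mem_image]
        by_cases hps : p ∣ s
        · right
          obtain ⟨e, rfl⟩ := hps
          refine ⟨e, ?_, rfl⟩
          rw [Finset.mem_filter, Nat.mem_divisors]
          exact ⟨⟨Nat.dvd_of_mul_dvd_mul_left hp.pos hs.1.1, hm⟩, sift_of_mul hs.2⟩
        · left
          rw [Finset.mem_filter, Nat.mem_divisors]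
          have hcop : p.Coprime s := (Nat.Prime.coprime_iff_not_dvd hp).2 hps
          exact ⟨⟨hcop.symm.dvd_of_dvd_mul_left hs.1.1, hm⟩, hs.2⟩
      have h1 := (Finset.card_le_card hsub).trans (Finset.card_union_le _ _)
      have h2 := Finset.card_image_le (s := m.divisors.filter (sift w)) (f := fun d => p * d)
      have h3 : (((p * m).divisors.filter (sift w)).card : ℝ) ≤
          2 * ((m.divisors.filter (sift w)).card : ℝ) := by
        have : ((p * m).divisors.filter (sift w)).card ≤
          2 * (m.divisors.filter (sift w)).card := by omega
        exact_mod_cast this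
      nlinarith
    · have hsub : (p * m).divisors.filter (sift w) ⊆ m.divisors.filter (sift w) := by
        intro s hs
        rw [Finset.mem_filter, Nat.mem_divisors] at hs
        have hps : ¬ p ∣ s := fun h => hpw (hs.2 p hp h)
        rw [Finset.mem_filter, Nat.mem_divisors]
        have hcop : p.Coprime s := (Nat.Prime.coprime_iff_not_dvd hp).2 hps
        exact ⟨⟨hcop.symm.dvd_of_dvd_mul_left hs.1.1, hm⟩, hs.2⟩
      have h1 : (((p * m).divisors.filter (sift w)).card : ℝ) ≤
          ((m.divisors.filter (sift w)).card : ℝ) := by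
        exact_mod_cast Finset.card_le_card hsub
      have hp2 : 1 ≤ (p : ℝ) ^ (Real.log 2 / Real.log w) :=
        Real.one_le_rpow hp1 (by positivity)
      nlinarith

/-! ### Counting and reorganising -/

lemma count_dvd (y M d : ℕ) (hy : 1 ≤ y) (hd : 1 ≤ d) (N : ℝ) (hM : (M : ℝ) ≤ y + N)
    (hyM : y ≤ M) (hdN : (d : ℝ) ≤ N) :
    (((Finset.Icc y M).filter (fun m => d ∣ m)).card : ℝ) ≤ 2 * N * (1 / d) := by
  have h1 : ((Finset.Icc y M).filter (fun m => d ∣ m)).card ≤ (M - y) / d + 1 := by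
    have e1 : (Finset.Icc y M).filter (fun m => d ∣ m) =
        ((Finset.Ioc 0 M).filter (fun m => d ∣ m)) \
          ((Finset.Ioc 0 (y - 1)).filter (fun m => d ∣ m)) := by
      ext m
      simp only [Finset.mem_filter, Finset.mem_Icc, Finset.mem_sdiff, Finset.mem_Ioc]
      constructor
      · rintro ⟨⟨a, b⟩, c⟩
        exact ⟨⟨⟨by omega, b⟩, c⟩, fun h => by omega⟩
      · rintro ⟨⟨⟨a, b⟩, c⟩, h⟩
        refine ⟨⟨?_, b⟩, c⟩
        by_contra hc
        exact h ⟨⟨a, by omega⟩, c⟩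
    rw [e1, Finset.card_sdiff_of_subset, Nat.Ioc_filter_dvd_card_eq_div,
      Nat.Ioc_filter_dvd_card_eq_div]
    · have hM' : M = (M - y) + 1 + (y - 1) := by omega
      have hA := Nat.div_add_mod (M - y) d
      have hB := Nat.div_add_mod (y - 1) d
      have hC := Nat.mod_lt (M - y) (by omega : 0 < d)
      have hE := Nat.mod_lt (y - 1) (by omega : 0 < d)
      have : M / d < (M - y) / d + (y - 1) / d + 2 := by
        rw [Nat.div_lt_iff_lt_mul (by omega)]
        have : ((M - y) / d + (y - 1) / d + 2) * d =
          d * ((M - y) / d) + d * ((y - 1) / d) + 2 * d := by ring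
        omega
      clear hA hB hC hE
      revert this
      generalize M / d = a
      generalize (M - y) / d = b
      generalize (y - 1) / d = c
      omega
    · apply Finset.filter_subset_filter
      apply Finset.Ioc_subset_Ioc_right
      omega
  have hd0 : (0 : ℝ) < d := by exact_mod_cast hd
  have h2 : (((M - y) / d + 1 : ℕ) : ℝ) ≤ N / d + 1 := by
    push_cast
    have : (((M - y) / d : ℕ) : ℝ) ≤ ((M - y : ℕ) : ℝ) / d := Nat.cast_div_le
    have h3 : ((M - y : ℕ) : ℝ) ≤ N := by rw [Nat.cast_sub hyM]; linarith
    have : ((M - y : ℕ) : ℝ) / d ≤ N / d := by gcongr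
    linarith
  have h3 : (1 : ℝ) ≤ N / d := by rw [le_div_iff₀ hd0]; linarith
  have h4 : (((Finset.Icc y M).filter (fun m => d ∣ m)).card : ℝ) ≤
      (((M - y) / d + 1 : ℕ) : ℝ) := by exact_mod_cast h1
  calc _ ≤ N / d + N / d := by linarith
    _ = _ := by ring

lemma sum_mul_reorg (M : ℕ) (F : ℕ → ℕ → ℝ) :
    ∑ a ∈ Finset.Icc 1 M, ∑ b ∈ Finset.Icc 1 M, (if a * b ≤ M then F a b else 0) =
      ∑ m ∈ Finset.Icc 1 M, ∑ a ∈ m.divisors, F a (m / a) := by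
  rw [← Finset.sum_product', ← Finset.sum_filter, Finset.sum_sigma']
  refine Finset.sum_bij' (fun q _ => ⟨q.1 * q.2, q.1⟩) (fun q _ => (q.2, q.1 / q.2)) ?_ ?_ ?_ ?_ ?_
  · rintro ⟨a, b⟩ h
    simp only [Finset.mem_filter, Finset.mem_product, Finset.mem_Icc] at h
    simp only [Finset.mem_sigma, Finset.mem_Icc, Nat.mem_divisors]
    have : 0 < a * b := Nat.mul_pos (by omega) (by omega)
    exact ⟨⟨this, h.2⟩, Dvd.intro b rfl, this.ne'⟩
  · rintro ⟨m, a⟩ h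
    simp only [Finset.mem_sigma, Finset.mem_Icc, Nat.mem_divisors] at h
    simp only [Finset.mem_filter, Finset.mem_product, Finset.mem_Icc]
    obtain ⟨⟨h1, h2⟩, ⟨b, rfl⟩, h3⟩ := h
    have ha : 0 < a := Nat.pos_of_ne_zero (by rintro rfl; simp at h3)
    have hb : 0 < b := Nat.pos_of_ne_zero (by rintro rfl; simp at h3)
    rw [Nat.mul_div_cancel_left _ ha]
    refine ⟨⟨⟨ha, ?_⟩, hb, ?_⟩, h2⟩ <;> nlinarith
  · rintro ⟨a, b⟩ h
    simp only [Finset.mem_filter, Finset.mem_product, Finset.mem_Icc] at h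
    simp only
    rw [Nat.mul_div_cancel_left _ (by omega)]
  · rintro ⟨m, a⟩ h
    simp only [Finset.mem_sigma, Finset.mem_Icc, Nat.mem_divisors] at h
    simp only
    rw [Nat.mul_div_cancel' h.2.1]
  · rintro ⟨a, b⟩ h
    simp only [Finset.mem_filter, Finset.mem_product, Finset.mem_Icc] at h
    simp only
    rw [Nat.mul_div_cancel_left _ (by omega)]

lemma sifted_eq (c : ℕ → ℝ) (hc0 : c 0 = 0) (y : ℕ) (hy : 1 ≤ y) (N w : ℝ) (hN : 0 ≤ N) (M : ℕ)
    (hM : M = ⌊(y : ℝ) + N⌋₊) :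
    siftedCountSum c y (y + N) w =
      ∑ s ∈ Finset.Icc 1 M, ∑ k ∈ Finset.Icc 1 M, (if s * k ≤ M then
        (if y ≤ s * k then c s * (if sift w k then 1 else 0) else 0) else 0) := by
  have hle : ∀ n : ℕ, (n : ℝ) ≤ y + N ↔ n ≤ M := by
    intro n; rw [hM, Nat.le_floor_iff (by positivity)]
  have hset : ∀ s : ℕ, 1 ≤ s →
      {n : ℕ | (y : ℝ) ≤ ((n * s : ℕ) : ℝ) ∧ ((n * s : ℕ) : ℝ) ≤ y + N ∧ sift w n} =
      (((Finset.Icc 1 M).filter (fun k => s * k ≤ M ∧ y ≤ s * k ∧ sift w k) : Finset ℕ) : Set ℕ) := by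
    intro s hs
    ext n
    rw [Set.mem_ofPred_eq, Finset.mem_coe, Finset.mem_filter, Finset.mem_Icc, hle, Nat.cast_le,
      mul_comm n s]
    constructor
    · rintro ⟨h1, h2, h3⟩
      refine ⟨⟨?_, ?_⟩, h2, h1, h3⟩
      · by_contra h
        have : n = 0 := by omega
        subst this
        omega
      · nlinarith
    · rintro ⟨-, h2, h1, h3⟩
      exact ⟨h1, h2, h3⟩
  unfold siftedCountSum
  rw [tsum_eq_sum (s := Finset.Icc 1 M)]
  · apply Finset.sum_congr rfl
    intro s hs
    rw [Finset.mem_Icc] at hs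
    rw [hset s hs.1, Set.ncard_coe_finset, Finset.card_filter]
    push_cast
    rw [Finset.mul_sum]
    apply Finset.sum_congr rfl
    intro k _
    by_cases h1 : s * k ≤ M <;> by_cases h2 : y ≤ s * k <;> by_cases h3 : sift w k <;>
      simp [h1, h2, h3]
  · intro s hs
    rcases Nat.eq_zero_or_pos s with rfl | hs0
    · rw [hc0, zero_mul]
    · rw [hset s hs0, Set.ncard_coe_finset, Finset.filter_false_of_mem]
      · simp
      · intro k hk h
        rw [Finset.mem_Icc] at hk hs
        apply hs
        refine ⟨hs0, ?_⟩
        nlinarith [h.1]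

lemma triple_eq (c : ℕ → ℝ) (hc0 : c 0 = 0) (y : ℕ) (hy : 1 ≤ y) (N w D : ℝ) (hN : 0 ≤ N) (M : ℕ)
    (hM : M = ⌊(y : ℝ) + N⌋₊) :
    tripleSum c (xi D) y (y + N) w =
      ∑ s ∈ Finset.Icc 1 M, ∑ k ∈ Finset.Icc 1 M, (if s * k ≤ M then
        (if y ≤ s * k then c s * theta' w D k else 0) else 0) := by
  have hle : ∀ n : ℕ, (n : ℝ) ≤ y + N ↔ n ≤ M := by
    intro n; rw [hM, Nat.le_floor_iff (by positivity)]
  unfold tripleSum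
  rw [tsum_eq_sum (s := Finset.Icc 1 M ×ˢ (Finset.Icc 1 M ×ˢ Finset.Icc 1 M))]
  · rw [Finset.sum_product]
    simp_rw [Finset.sum_product]
    rw [Finset.sum_comm]
    apply Finset.sum_congr rfl
    intro s hs
    rw [Finset.mem_Icc] at hs
    have h1 : ∀ d ∈ Finset.Icc 1 M, ∀ n ∈ Finset.Icc 1 M,
        (if (y : ℝ) ≤ ((d * s * n : ℕ) : ℝ) ∧ ((d * s * n : ℕ) : ℝ) ≤ y + N ∧ divPw w d then
          c s * xi D d else 0) =
        (if d * n ≤ M then (if y ≤ s * (d * n) ∧ s * (d * n) ≤ M ∧ divPw w d then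
          c s * xi D d else 0) else 0) := by
      intro d _ n _
      simp only [hle, Nat.cast_le, show d * s * n = s * (d * n) by ring]
      by_cases h : d * n ≤ M
      · rw [if_pos h]
      · rw [if_neg h, if_neg]
        rintro ⟨-, h2, -⟩
        apply h
        nlinarith
    rw [Finset.sum_congr rfl (fun d hd => Finset.sum_congr rfl (h1 d hd)),
      sum_mul_reorg M (fun d n => if y ≤ s * (d * n) ∧ s * (d * n) ≤ M ∧ divPw w d then
          c s * xi D d else 0)]
    apply Finset.sum_congr rfl
    intro k _
    have h2 : ∀ d ∈ k.divisors, (if y ≤ s * (d * (k / d)) ∧ s * (d * (k / d)) ≤ M ∧ divPw w d then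
          c s * xi D d else 0) =
        (if y ≤ s * k ∧ s * k ≤ M ∧ divPw w d then c s * xi D d else 0) := by
      intro d hd
      rw [Nat.mul_div_cancel' (Nat.dvd_of_mem_divisors hd)]
    rw [Finset.sum_congr rfl h2, theta']
    by_cases h1 : s * k ≤ M <;> by_cases h2 : y ≤ s * k
    · simp only [h1, h2, true_and, if_true]
      rw [← Finset.sum_filter, Finset.mul_sum]
    all_goals simp [h1, h2]
  · rintro ⟨d, s, n⟩ h
    simp only [hle, Nat.cast_le]
    split_ifs with h1
    · rcases Nat.eq_zero_or_pos s with rfl | hs0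
      · rw [hc0, zero_mul]
      exfalso
      apply h
      obtain ⟨h2, h3, -⟩ := h1
      have hd0 : 1 ≤ d := Nat.pos_of_ne_zero (by rintro rfl; simp at h2; omega)
      have hn0 : 1 ≤ n := Nat.pos_of_ne_zero (by rintro rfl; simp at h2; omega)
      simp only [Finset.mem_product, Finset.mem_Icc]
      have e1 : d ≤ d * s * n := by
        rw [mul_assoc]; exact Nat.le_mul_of_pos_right _ (Nat.mul_pos hs0 hn0)
      have e2 : s ≤ d * s * n := by
        rw [show d * s * n = s * (d * n) by ring]
        exact Nat.le_mul_of_pos_right _ (Nat.mul_pos hd0 hn0)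
      have e3 : n ≤ d * s * n := Nat.le_mul_of_pos_left _ (Nat.mul_pos hd0 hs0)
      exact ⟨⟨hd0, by omega⟩, ⟨hs0, by omega⟩, hn0, by omega⟩
    · rfl

lemma interval_bound (c : ℕ → ℝ) (y : ℕ) (hy : 1 ≤ y) (N w D L G : ℝ)
    (hL : 0 ≤ L) (hw : 2 < w) (hD : 1 < D) (hDN : D * w ≤ N)
    (hcL : ∀ s, |c s| ≤ L) (hc : ∀ s, ¬ sift w s → c s = 0)
    (hG : ∀ T : Finset ℕ, (∀ d ∈ T, divPw w d ∧ D ≤ d) → ∑ d ∈ T, (1 : ℝ) / d ≤ G) :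
    |siftedCountSum c y (y + N) w - tripleSum c (xi D) y (y + N) w| ≤
      L * ((y : ℝ) + N) ^ (Real.log 2 / Real.log w) * (2 * N * G) := by
  have hN : 0 ≤ N := by nlinarith
  have hlw : 0 < Real.log w := Real.log_pos (by linarith)
  have hl2 : 0 < Real.log 2 := Real.log_pos (by norm_num)
  have hc0 : c 0 = 0 := by
    apply hc
    intro h
    have := h 2 Nat.prime_two (dvd_zero 2)
    push_cast at this
    linarith
  set M := ⌊(y : ℝ) + N⌋₊ with hM
  have hyN : (0 : ℝ) ≤ y + N := by positivity
  have hMle : (M : ℝ) ≤ y + N := Nat.floor_le hyN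
  have hyM : y ≤ M := Nat.le_floor (by linarith)
  rw [sifted_eq c hc0 y hy N w hN M hM, triple_eq c hc0 y hy N w D hN M hM, 
    sum_mul_reorg M (fun s k => if y ≤ s * k then c s * (if sift w k then 1 else 0) else 0),
    sum_mul_reorg M (fun s k => if y ≤ s * k then c s * theta' w D k else 0),
    ← Finset.sum_sub_distrib]
  set R := ((y : ℝ) + N) ^ (Real.log 2 / Real.log w) with hR
  have hstep : ∀ m ∈ Finset.Icc 1 M,
      |∑ s ∈ m.divisors, (if y ≤ s * (m / s) then c s * (if sift w (m / s) then (1:ℝ) else 0) else 0)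
        - ∑ s ∈ m.divisors, (if y ≤ s * (m / s) then c s * theta' w D (m / s) else 0)| ≤
      if y ≤ m then L * R * (bdry w D m).card else 0 := by
    intro m hm
    rw [Finset.mem_Icc] at hm
    rw [← Finset.sum_sub_distrib]
    have h1 : ∀ s ∈ m.divisors,
        |(if y ≤ s * (m / s) then c s * (if sift w (m / s) then (1:ℝ) else 0) else 0) -
        (if y ≤ s * (m / s) then c s * theta' w D (m / s) else 0)| ≤
        if sift w s then (if y ≤ m then L * (bdry w D m).card else 0) else 0 := by
      intro s hs
      have hsm := Nat.dvd_of_mem_divisors hs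
      rw [Nat.mul_div_cancel' hsm]
      by_cases hss : sift w s
      · rw [if_pos hss]
        by_cases hym : y ≤ m
        · rw [if_pos hym, if_pos hym, if_pos hym, ← mul_sub, abs_mul]
          have hms : m / s ≠ 0 := by
            obtain ⟨b, rfl⟩ := hsm
            have : 0 < s := Nat.pos_of_ne_zero (by rintro rfl; simp at hm)
            rw [Nat.mul_div_cancel_left _ this]
            rintro rfl; simp at hm
          have h2 := sieve_ineq w D hD (m / s) hms
          have h3 : ((bdry w D (m / s)).card : ℝ) ≤ (bdry w D m).card := by
            have : bdry w D (m / s) ⊆ bdry w D m := by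
              apply Finset.filter_subset_filter
              exact Nat.divisors_subset_of_dvd (by omega) (Nat.div_dvd_of_dvd hsm)
            exact_mod_cast Finset.card_le_card this
          exact mul_le_mul (hcL s) (h2.trans h3) (abs_nonneg _) hL
        · simp [hym]
      · simp [hss, hc s hss]
    refine (Finset.abs_sum_le_sum_abs _ _).trans ((Finset.sum_le_sum h1).trans ?_)
    rw [← Finset.sum_filter, Finset.sum_const, nsmul_eq_mul]
    by_cases hym : y ≤ m
    · rw [if_pos hym, if_pos hym]
      have h2 := rough_divisors w (by linarith) m (by omega)
      have h3 : (m : ℝ) ^ (Real.log 2 / Real.log w) ≤ R := by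
        apply Real.rpow_le_rpow (by positivity) _ (by positivity)
        have : (m : ℝ) ≤ M := by exact_mod_cast hm.2
        linarith
      calc _ ≤ R * (L * ((bdry w D m).card : ℝ)) := by
            apply mul_le_mul_of_nonneg_right (h2.trans h3) (by positivity)
        _ = _ := by ring
    · simp [hym]
  refine (Finset.abs_sum_le_sum_abs _ _).trans ((Finset.sum_le_sum hstep).trans ?_)
  rw [← Finset.sum_filter]
  have hfil : (Finset.Icc 1 M).filter (fun m => y ≤ m) = Finset.Icc y M := by
    ext m; simp only [Finset.mem_filter, Finset.mem_Icc]; omega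
  rw [hfil, ← Finset.mul_sum]
  apply mul_le_mul_of_nonneg_left _ (by positivity)
  set T := (Finset.Icc 1 M).filter (fun d => divPw w d ∧ D ≤ (d : ℝ) ∧ (d : ℝ) < D * w) with hT
  have hb : ∀ m ∈ Finset.Icc y M, ((bdry w D m).card : ℝ) = ∑ d ∈ T, if d ∣ m then (1:ℝ) else 0 := by
    intro m hm
    rw [Finset.mem_Icc] at hm
    rw [← Finset.sum_filter, Finset.sum_const, nsmul_eq_mul, mul_one]
    congr 2
    ext d
    simp only [hT, bdry, Finset.mem_filter, Finset.mem_Icc, Nat.mem_divisors]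
    constructor
    · rintro ⟨⟨h1, h2⟩, h3⟩
      have := Nat.le_of_dvd (by omega) h1
      have := Nat.pos_of_dvd_of_pos h1 (by omega)
      exact ⟨⟨⟨by omega, by omega⟩, h3⟩, h1⟩
    · rintro ⟨⟨h1, h3⟩, h2⟩
      exact ⟨⟨h2, by omega⟩, h3⟩
  rw [Finset.sum_congr rfl hb, Finset.sum_comm]
  calc ∑ d ∈ T, ∑ m ∈ Finset.Icc y M, (if d ∣ m then (1:ℝ) else 0)
      ≤ ∑ d ∈ T, 2 * N * (1 / (d : ℝ)) := by
        apply Finset.sum_le_sum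
        intro d hd
        rw [hT, Finset.mem_filter, Finset.mem_Icc] at hd
        rw [← Finset.sum_filter, Finset.sum_const, nsmul_eq_mul, mul_one]
        exact count_dvd y M d hy hd.1.1 N hMle hyM (by linarith [hd.2.2.2])
    _ = 2 * N * ∑ d ∈ T, (1 / (d : ℝ)) := by rw [Finset.mul_sum]
    _ ≤ 2 * N * G := by
        apply mul_le_mul_of_nonneg_left _ (by positivity)
        apply hG
        intro d hd
        rw [hT, Finset.mem_filter] at hd
        exact ⟨hd.2.1, hd.2.2.1⟩

lemma core (x α δ E A K : ℝ) (hll : 20 ≤ Real.log (Real.log x)) (hx : 1 < x)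
    (hα1 : 1 ≤ α) (hα2 : α ≤ 2) (hδ : 0 < δ) (hδ1 : δ ≤ 0.1) (hE : 0 ≤ E) (hK0 : 0 ≤ K)
    (hK : K * δ / 2 = A + E + 1 + 4)
    (y : ℕ) (hy : 1 ≤ y) (N : ℝ) (c : ℕ → ℝ) (hN : x ^ (0.2 : ℝ) ≤ N)
    (hyN : (y : ℝ) + N ≤ x ^ E)
    (hcL : ∀ s, |c s| ≤ Real.log x)
    (hc : ∀ s, ¬ sift (α * x ^ (1 / Real.log (Real.log x))) s → c s = 0) :
    |siftedCountSum c y (y + N) (α * x ^ (1 / Real.log (Real.log x))) -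
      tripleSum c (xi (x ^ δ)) y (y + N) (α * x ^ (1 / Real.log (Real.log x)))| ≤
      2 * Real.exp (13 + 12 * K * Real.exp K) * (N / Real.log x ^ A) := by
  set w := α * x ^ (1 / Real.log (Real.log x)) with hw
  set ll := Real.log (Real.log x) with hll'
  set l := Real.log x with hl'
  have hx0 : 0 < x := by linarith
  have hl0 : 0 < l := Real.log_pos hx
  have hll0 : 0 < ll := by linarith
  have hlll : ll ≤ l - 1 := Real.log_le_sub_one_of_pos hl0
  have hl20 : 21 ≤ l := by linarith
  have hl2 : 0 < Real.log 2 := Real.log_pos (by norm_num)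
  have hl2b := Real.log_two_lt_d9
  have hq1 : 1 ≤ l / ll := by rw [le_div_iff₀ hll0]; linarith
  have hxpow : x ^ (1 / ll) = Real.exp (l / ll) := by
    rw [Real.rpow_def_of_pos hx0]; congr 1; ring
  have hxp0 : 0 < x ^ (1 / ll) := by positivity
  have hw0 : 0 < w := by positivity
  have hlogw : Real.log w = Real.log α + l / ll := by
    rw [hw, Real.log_mul (by linarith) hxp0.ne', hxpow, Real.log_exp]
  have hlα0 : 0 ≤ Real.log α := Real.log_nonneg hα1
  have hlα2 : Real.log α ≤ Real.log 2 := Real.log_le_log (by linarith) hα2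
  have hlw1 : l / ll ≤ Real.log w := by linarith
  have hlw2 : Real.log w ≤ 2 * (l / ll) := by linarith
  have hlw0 : 0 < Real.log w := by linarith
  have hq20 : l / ll ≤ 0.05 * l := by
    rw [div_le_iff₀ hll0]; nlinarith
  have hlw3 : Real.log w ≤ 0.1 * l := by linarith
  have hw2 : 2 < w := by
    rw [← Real.log_lt_log_iff (by norm_num) hw0]; linarith
  have hD1 : 1 < x ^ δ := Real.one_lt_rpow hx hδ
  have hD0 : 0 < x ^ δ := by linarith
  have hDw : x ^ δ * w ≤ N := by
    refine le_trans ?_ hN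
    have h1 : w ≤ x ^ (0.1 : ℝ) := by
      rw [← Real.log_le_log_iff hw0 (by positivity), Real.log_rpow hx0]; exact hlw3
    have h2 : x ^ δ ≤ x ^ (0.1 : ℝ) := Real.rpow_le_rpow_of_exponent_le hx.le hδ1
    calc x ^ δ * w ≤ x ^ (0.1 : ℝ) * x ^ (0.1 : ℝ) := by gcongr
      _ = x ^ (0.2 : ℝ) := by rw [← Real.rpow_add hx0]; norm_num
  have hN0 : 0 < N := lt_of_lt_of_le (by positivity) hN
  set C0 := 13 + 12 * K * Real.exp K with hC0
  set G := Real.exp C0 * l ^ (-(A + E + 1)) with hG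
  have hlexp : ∀ t : ℝ, l ^ t = Real.exp (ll * t) := fun t => Real.rpow_def_of_pos hl0 t
  have hGb : ∀ T : Finset ℕ, (∀ d ∈ T, divPw w d ∧ x ^ δ ≤ d) → ∑ d ∈ T, (1 : ℝ) / d ≤ G := by
    intro T hT
    refine (rankin w (x ^ δ) (K / Real.log w) hD0 (by positivity) T hT).trans ?_
    have h1 := sum_rankin w K (by linarith) hw0 hK0
    have h2 : Real.log (Real.log w) ≤ ll := Real.log_le_log hlw0 (by linarith)
    have h3 : (x ^ δ) ^ (-(K / Real.log w)) = Real.exp (-(l * δ * (K / Real.log w))) := by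
      rw [Real.rpow_def_of_pos hD0, Real.log_rpow hx0]; congr 1; ring
    rw [h3, hG, hlexp, ← Real.exp_add, ← Real.exp_add, Real.exp_le_exp]
    have h4 : (A + E + 1 + 4) * ll ≤ l * δ * (K / Real.log w) := by
      rw [← hK, ← mul_div_assoc, le_div_iff₀ hlw0]
      calc K * δ / 2 * ll * Real.log w ≤ K * δ / 2 * ll * (2 * (l / ll)) := by gcongr
        _ = l * δ * K := by field_simp
    nlinarith
  have hmain := interval_bound c y hy N w (x ^ δ) l G hl0.le hw2 hD1 hDw hcL hc hGb
  refine hmain.trans ?_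
  have hR : ((y : ℝ) + N) ^ (Real.log 2 / Real.log w) ≤ l ^ E := by
    calc ((y : ℝ) + N) ^ (Real.log 2 / Real.log w)
        ≤ (x ^ E) ^ (Real.log 2 / Real.log w) :=
          Real.rpow_le_rpow (by positivity) hyN (by positivity)
      _ = Real.exp (E * (l * (Real.log 2 / Real.log w))) := by
          rw [Real.rpow_def_of_pos (by positivity), Real.log_rpow hx0]; congr 1; ring
      _ ≤ Real.exp (ll * E) := by
          rw [Real.exp_le_exp, mul_comm ll E]
          apply mul_le_mul_of_nonneg_left _ hE
          rw [← mul_div_assoc, div_le_iff₀ hlw0]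
          have : ll * (l / ll) ≤ ll * Real.log w := by gcongr
          rw [mul_div_cancel₀ _ hll0.ne'] at this
          nlinarith
      _ = l ^ E := (hlexp E).symm
  have hG0 : 0 ≤ G := by positivity
  calc l * ((y : ℝ) + N) ^ (Real.log 2 / Real.log w) * (2 * N * G)
      ≤ l * l ^ E * (2 * N * G) := by gcongr
    _ = 2 * Real.exp C0 * N * (l * l ^ E * l ^ (-(A + E + 1))) := by rw [hG]; ring
    _ = 2 * Real.exp C0 * N * (l ^ A)⁻¹ := by
        congr 1
        rw [← Real.rpow_neg hl0.le]
        nth_rewrite 1 [← Real.rpow_one l]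
        rw [← Real.rpow_add hl0, ← Real.rpow_add hl0]
        congr 1; ring
    _ = _ := by ring

/-- **Fundamental Lemma, Lemma 4.2.** -/
theorem fundamental_lemma (ε : ℝ) (hε : 0 < ε) (K₂ : ℕ) (hK₂ : 1 ≤ K₂)
    (A : ℝ) (hA : 0 < A) :
    ∃ C : ℝ, 0 < C ∧
      ∀ (x τ α : ℝ) (y : ℕ) (c : ℕ → ℝ),
        C ≤ x →
        x ^ (0.475 - ε) ≤ τ → τ ≤ x ^ (0.77 - ε) →
        x ≤ (y : ℝ) → (y : ℝ) ≤ 3 * x →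
        1 ≤ α → α ≤ 2 →
        (∀ s : ℕ, |c s| ≤ Real.log x) →
        (∀ s : ℕ,
          ((∃ p : ℕ, p.Prime ∧ (p : ℝ) < α * x ^ (1 / Real.log (Real.log x)) ∧ p ∣ s) ∨
            x ^ (1 - 1 / 10 ^ 5 - 2 / (K₂ : ℝ)) ≤ (s : ℝ)) → c s = 0) →
        ∃ ξ₁ ξ₂ : ℕ → ℝ,
          (∀ d : ℕ, |ξ₁ d| ≤ 1 ∧ |ξ₂ d| ≤ 1) ∧
          (∀ d : ℕ, x ^ (1 / (K₂ : ℝ)) ≤ (d : ℝ) → ξ₁ d = 0 ∧ ξ₂ d = 0) ∧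
          (siftedCountSum c (y : ℝ) ((y : ℝ) + (y : ℝ) / τ)
                (α * x ^ (1 / Real.log (Real.log x))) -
              x ^ ((1 : ℝ) / 10 ^ 5) / τ *
                siftedCountSum c (y : ℝ) ((y : ℝ) + (y : ℝ) / x ^ ((1 : ℝ) / 10 ^ 5))
                  (α * x ^ (1 / Real.log (Real.log x)))
            ≤ tripleSum c ξ₁ (y : ℝ) ((y : ℝ) + (y : ℝ) / τ)
                (α * x ^ (1 / Real.log (Real.log x))) -
              x ^ ((1 : ℝ) / 10 ^ 5) / τ *
                tripleSum c ξ₁ (y : ℝ) ((y : ℝ) + (y : ℝ) / x ^ ((1 : ℝ) / 10 ^ 5))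
                  (α * x ^ (1 / Real.log (Real.log x))) +
              C * x / (τ * Real.log x ^ A)) ∧
          (tripleSum c ξ₂ (y : ℝ) ((y : ℝ) + (y : ℝ) / τ)
                (α * x ^ (1 / Real.log (Real.log x))) -
              x ^ ((1 : ℝ) / 10 ^ 5) / τ *
                tripleSum c ξ₂ (y : ℝ) ((y : ℝ) + (y : ℝ) / x ^ ((1 : ℝ) / 10 ^ 5))
                  (α * x ^ (1 / Real.log (Real.log x))) -
              C * x / (τ * Real.log x ^ A)
            ≤ siftedCountSum c (y : ℝ) ((y : ℝ) + (y : ℝ) / τ)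
                (α * x ^ (1 / Real.log (Real.log x))) -
              x ^ ((1 : ℝ) / 10 ^ 5) / τ *
                siftedCountSum c (y : ℝ) ((y : ℝ) + (y : ℝ) / x ^ ((1 : ℝ) / 10 ^ 5))
                  (α * x ^ (1 / Real.log (Real.log x)))) := by
  have hK₂' : (1 : ℝ) ≤ K₂ := by exact_mod_cast hK₂
  set δ : ℝ := 1 / (10 * (K₂ : ℝ)) with hδ
  have hδ0 : 0 < δ := by positivity
  have hδ1 : δ ≤ 0.1 := by
    rw [hδ, div_le_iff₀ (by positivity)]; linarith
  have hδ2 : δ ≤ 1 / (K₂ : ℝ) := by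
    rw [hδ]
    apply div_le_div_of_nonneg_left (by norm_num) (by positivity) (by linarith)
  set E : ℝ := 3 + ε with hE
  set K : ℝ := 2 * (A + E + 1 + 4) / δ with hK
  have hK0 : 0 ≤ K := by positivity
  have hKδ : K * δ / 2 = A + E + 1 + 4 := by rw [hK]; field_simp
  set B : ℝ := Real.exp (13 + 12 * K * Real.exp K) with hB
  have hB0 : 0 < B := Real.exp_pos _
  refine ⟨12 * B + Real.exp (Real.exp 20), by positivity, ?_⟩
  intro x τ α y c hCx hτ1 hτ2 hxy hy3 hα1 hα2 hcL hc
  have hxX : Real.exp (Real.exp 20) ≤ x := by linarith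
  have hx0 : 0 < x := lt_of_lt_of_le (Real.exp_pos _) hxX
  have hl : Real.exp 20 ≤ Real.log x := (Real.le_log_iff_exp_le hx0).2 hxX
  have hl0 : 0 < Real.log x := lt_of_lt_of_le (Real.exp_pos _) hl
  have hll : 20 ≤ Real.log (Real.log x) := (Real.le_log_iff_exp_le hl0).2 hl
  have hx20 : 21 ≤ x := by
    have h1 := Real.add_one_le_exp (20 : ℝ)
    have h2 := Real.add_one_le_exp (Real.exp 20)
    linarith
  have hx1 : 1 < x := by linarith
  have hy1 : 1 ≤ y := by
    have : (1 : ℝ) ≤ y := by linarith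
    exact_mod_cast this
  have hτ0 : 0 < τ := lt_of_lt_of_le (by positivity) hτ1
  set xb : ℝ := x ^ ((1 : ℝ) / 10 ^ 5) with hxb
  have hxb1 : 1 ≤ xb := Real.one_le_rpow hx1.le (by positivity)
  have hxb0 : 0 < xb := by linarith
  set w := α * x ^ (1 / Real.log (Real.log x)) with hw
  have hc' : ∀ s, ¬ sift w s → c s = 0 := by
    intro s hs
    apply hc
    left
    unfold sift at hs
    push Not at hs
    obtain ⟨p, hp, hps, hpw⟩ := hs
    exact ⟨p, hp, hpw, hps⟩
  have h6 : 6 * x ^ (1 + ε) ≤ x ^ E := by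
    have : x ^ E = x ^ (2 : ℝ) * x ^ (1 + ε) := by
      rw [← Real.rpow_add hx0]; congr 1; rw [hE]; ring
    rw [this]
    apply mul_le_mul_of_nonneg_right _ (by positivity)
    rw [Real.rpow_two]; nlinarith
  have hxe : x ≤ x ^ (1 + ε) := by
    nth_rewrite 1 [← Real.rpow_one x]
    exact Real.rpow_le_rpow_of_exponent_le hx1.le (by linarith)
  have hA1 := core x α δ E A K hll hx1 hα1 hα2 hδ0 hδ1 (by positivity) hK0 hKδ y hy1 (y / τ) c
    (by
      rw [le_div_iff₀ hτ0]
      calc x ^ (0.2 : ℝ) * τ ≤ x ^ (0.2 : ℝ) * x ^ (0.77 - ε) := by gcongr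
        _ = x ^ (0.2 + (0.77 - ε)) := by rw [Real.rpow_add hx0]
        _ ≤ x ^ (1 : ℝ) := Real.rpow_le_rpow_of_exponent_le hx1.le (by linarith)
        _ = x := Real.rpow_one x
        _ ≤ y := hxy)
    (by
      have h1 : (y : ℝ) / τ ≤ 3 * x ^ (1 + ε) := by
        rw [div_le_iff₀ hτ0]
        calc (y : ℝ) ≤ 3 * x := hy3
          _ = 3 * x ^ (1 : ℝ) := by rw [Real.rpow_one]
          _ ≤ 3 * x ^ ((1 + ε) + (0.475 - ε)) := by
            gcongr
            · exact hx1.le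
            · linarith
          _ = 3 * x ^ (1 + ε) * x ^ (0.475 - ε) := by rw [Real.rpow_add hx0]; ring
          _ ≤ 3 * x ^ (1 + ε) * τ := by gcongr
      linarith)
    hcL hc'
  have hB1 := core x α δ E A K hll hx1 hα1 hα2 hδ0 hδ1 (by positivity) hK0 hKδ y hy1 (y / xb) c
    (by
      rw [le_div_iff₀ hxb0, hxb, ← Real.rpow_add hx0]
      calc x ^ ((0.2 : ℝ) + 1 / 10 ^ 5) ≤ x ^ (1 : ℝ) :=
            Real.rpow_le_rpow_of_exponent_le hx1.le (by norm_num)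
        _ = x := Real.rpow_one x
        _ ≤ y := hxy)
    (by
      have h1 : (y : ℝ) / xb ≤ y := div_le_self (by positivity) hxb1
      linarith)
    hcL hc'
  refine ⟨xi (x ^ δ), xi (x ^ δ), fun d => ⟨abs_xi_le _ d, abs_xi_le _ d⟩, ?_, ?_⟩
  · intro d hd
    have : x ^ δ ≤ d := (Real.rpow_le_rpow_of_exponent_le hx1.le hδ2).trans hd
    have h0 : xi (x ^ δ) d = 0 := by
      unfold xi; rw [if_neg (by linarith)]
    exact ⟨h0, h0⟩
  have hlA : 0 < Real.log x ^ A := by positivity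
  have hA2 : 2 * B * ((y : ℝ) / τ / Real.log x ^ A) ≤ 6 * B * (x / (τ * Real.log x ^ A)) := by
    rw [div_div]
    calc 2 * B * ((y : ℝ) / (τ * Real.log x ^ A))
        ≤ 2 * B * ((3 * x) / (τ * Real.log x ^ A)) := by gcongr
      _ = _ := by ring
  have hB2 : xb / τ * (2 * B * ((y : ℝ) / xb / Real.log x ^ A)) =
      2 * B * ((y : ℝ) / τ / Real.log x ^ A) := by
    field_simp
  have hBm := mul_le_mul_of_nonneg_left hB1 (show 0 ≤ xb / τ by positivity)
  rw [← abs_of_nonneg (show 0 ≤ xb / τ by positivity), ← abs_mul,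
    abs_of_nonneg (show 0 ≤ xb / τ by positivity), hB2, mul_sub] at hBm
  have hfin : 12 * B * (x / (τ * Real.log x ^ A)) ≤
      (12 * B + Real.exp (Real.exp 20)) * x / (τ * Real.log x ^ A) := by
    rw [mul_div_assoc]
    apply mul_le_mul_of_nonneg_right _ (by positivity)
    linarith [Real.exp_pos (Real.exp 20)]
  rw [abs_le] at hA1 hBm
  obtain ⟨a1, a2⟩ := hA1
  obtain ⟨b1, b2⟩ := hBm
  constructor <;> linarith
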